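/- Let $O$ be a finite set and $D_O \subseteq O\times O$ a set of edges $(v,w)$ with $v \neq w$; for each $(v,w)\in D_O$ fix a nonempty finite lag set $K_{v,w}\subseteq \mathbb{N}=\{0,1,2,\dots\}$, and for each $v\in O$ fix a finite (possibly empty) self-lag set $K_{v,v}\subseteq \mathbb{N}\setminus\{0\}$. Let $\mathbb{R}^{\mathcal{D}}$ be the space of real parameter vectors $\Phi=(\phi_{v,w,k})$ with one coordinate for each $(v,w)\in D_O$, $k\in K_{v,w}$, and one coordinate $\phi_{v,v,k}$ for each $v\in O$, $k\in K_{v,v}$, equipped with Lebesgue measure. For $(v,w)\in D_O$ define the transfer function $$H_{v,w}(\Phi) := \frac{\sum_{k\in K_{v,w}}\phi_{v,w,k}X^k}{1-\sum_{j\in K_{w,w}}\phi_{w,w,j}X^j}\in\mathbb{R}(X),$$ where $\mathbb{R}(X)$ is the field of rational functions with real coefficients; the denominator is a nonzero polynomial, so this is well defined. Let $R\subseteq\mathbb{R}^{\mathcal{D}}$ be the set of parameter vectors satisfying $\sum_{j\in K_{v,v}}|\phi_{v,v,j}|<1$ for every $v\in O$ and $\sum_{(v,w)\in D_O}\sum_{k\in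 K_{v,w}}|\phi_{v,w,k}|<1$. Then the parameterisation $\Phi\mapsto (H_{v,w}(\Phi))_{(v,w)\in D_O}$ is generically injective on $R$ in the parameters that occur in it, that is: (a) The set of $\Phi\in R$ for which there exists $\Phi'\in R$ with $H_{v,w}(\Phi')=H_{v,w}(\Phi)$ for all $(v,w)\in D_O$, but such that for some edge $(v,w)\in D_O$ one has $\phi'_{v,w,k}\neq\phi_{v,w,k}$ for some $k\in K_{v,w}$ or $\phi'_{w,w,j}\neq\phi_{w,w,j}$ for some $j\in K_{w,w}$, has Lebesgue measure zero. (b) In particular, if every $w\in O$ with $K_{w,w}\neq\emptyset$ has an incoming edge $(v,w)\in D_O$, then the set of $\Phi\in R$ for which there exists $\Phi'\in R$ with $\Phi'\neq\Phi$ and $H_{v,w}(\Phi')=H_{v,w}(\Phi)$ for all $(v,w)\in D_O$ has Lebesgue measure zero. -/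

import Mathlib

open MeasureTheory

/-- The parameter space: one real coordinate `φ_{v,w,k}` for each pair `(v,w)` and each lag
`k ∈ K (v,w)`. Pairs that carry no relation have an empty lag set and contribute no coordinate.
As a finite product of copies of `ℝ` it carries Lebesgue measure as `volume`. -/
abbrev LagParams {O : Type*} (K : O × O → Finset ℕ) : Type _ :=
  ∀ p : O × O, ({k // k ∈ K p} → ℝ)

/-- The lag polynomial `φ_{v,w}(X) = Σ_{k ∈ K(v,w)} φ_{v,w,k} X^k`. -/
noncomputable def lagPoly {O : Type*} (K : O × O → Finset ℕ) (Φ : LagParams K) (p : O × O) :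
    Polynomial ℝ :=
  ∑ k : {k // k ∈ K p}, Polynomial.C (Φ p k) * Polynomial.X ^ (k : ℕ)

/-- The transfer function
`H_{v,w}(Φ) = (Σ_{k ∈ K(v,w)} φ_{v,w,k} X^k) / (1 − Σ_{j ∈ K(w,w)} φ_{w,w,j} X^j)`
as an element of `ℝ(X)`. -/
noncomputable def transferFn {O : Type*} (K : O × O → Finset ℕ) (Φ : LagParams K) (v w : O) :
    RatFunc ℝ :=
  algebraMap (Polynomial ℝ) (RatFunc ℝ) (lagPoly K Φ (v, w)) /
    algebraMap (Polynomial ℝ) (RatFunc ℝ) (1 - lagPoly K Φ (w, w))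

/-- The stable region `R`: `Σ_{j ∈ K(v,v)} |φ_{v,v,j}| < 1` for every `v` and
`Σ_{(v,w) ∈ D_O} Σ_{k ∈ K(v,w)} |φ_{v,w,k}| < 1`. -/
def stableRegion {O : Type*} (DO : Finset (O × O)) (K : O × O → Finset ℕ) :
    Set (LagParams K) :=
  {Φ | (∀ v : O, ∑ j : {k // k ∈ K (v, v)}, |Φ (v, v) j| < 1) ∧
    ∑ p ∈ DO, ∑ k : {k // k ∈ K p}, |Φ p k| < 1}

/-- `Φ` and `Φ'` have the same transfer function on every edge. -/
def SameTransfer {O : Type*} (DO : Finset (O × O)) (K : O × O → Finset ℕ)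
    (Φ Φ' : LagParams K) : Prop :=
  ∀ p ∈ DO, transferFn K Φ' p.1 p.2 = transferFn K Φ p.1 p.2

/-- `Φ` and `Φ'` agree in all the coordinates that occur in some transfer function: for every
edge `(v,w)`, in all `φ_{v,w,k}` and in all `φ_{w,w,j}`. The only coordinates left out are the
self-lag coefficients of vertices without an incoming edge. -/
def SameEdgeParams {O : Type*} (DO : Finset (O × O)) (K : O × O → Finset ℕ)
    (Φ Φ' : LagParams K) : Prop :=
  ∀ p ∈ DO, Φ' p = Φ p ∧ Φ' (p.2, p.2) = Φ (p.2, p.2)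

/-- A measurable set that meets every line in some fixed direction in a null set is null. -/
theorem measure_eq_zero_of_forall_line_null {E : Type*} [AddCommGroup E] [Module ℝ E]
    [MeasurableSpace E] [MeasurableAdd₂ E] [MeasurableSMul₂ ℝ E] (μ : Measure E) [SFinite μ]
    [μ.IsAddRightInvariant] {s : Set E} (hs : MeasurableSet s) (e : E)
    (h : ∀ x : E, volume {t : ℝ | x + t • e ∈ s} = 0) : μ s = 0 := by
  have hmeas : MeasurableSet {q : E × ℝ | q.1 + q.2 • e ∈ s} :=
    (measurable_fst.add (measurable_snd.smul_const e)) hs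
  have hnull : (μ.prod volume) {q : E × ℝ | q.1 + q.2 • e ∈ s} = 0 :=
    (Measure.measure_prod_null hmeas).2 (Filter.Eventually.of_forall h)
  rw [Measure.prod_apply_symm hmeas] at hnull
  have hslice : ∀ t : ℝ, μ ((fun x : E => (x, t)) ⁻¹' {q : E × ℝ | q.1 + q.2 • e ∈ s}) = μ s :=
    fun t => measure_preimage_add_right μ (t • e) s
  simp only [hslice] at hnull
  simpa using hnull

section LagPoly

variable {O : Type*} {K : O × O → Finset ℕ}

theorem coeff_lagPoly_of_mem (Φ : LagParams K) (p : O × O) {k : ℕ} (hk : k ∈ K p) :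
    (lagPoly K Φ p).coeff k = Φ p ⟨k, hk⟩ := by
  rw [lagPoly, Polynomial.finsetSum_coeff, Finset.sum_eq_single ⟨k, hk⟩]
  · simp
  · intro j _ hj
    have : k ≠ j := fun h => hj (Subtype.ext h.symm)
    simp [Polynomial.coeff_X_pow, this]
  · simp

theorem coeff_lagPoly_of_notMem (Φ : LagParams K) (p : O × O) {k : ℕ} (hk : k ∉ K p) :
    (lagPoly K Φ p).coeff k = 0 := by
  rw [lagPoly, Polynomial.finsetSum_coeff]
  refine Finset.sum_eq_zero fun j _ => ?_
  have : k ≠ j := fun h => hk (h ▸ j.2)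
  simp [Polynomial.coeff_X_pow, this]

theorem eq_of_lagPoly_eq {Φ Φ' : LagParams K} {p : O × O} (h : lagPoly K Φ p = lagPoly K Φ' p) :
    Φ p = Φ' p := by
  ext ⟨k, hk⟩
  rw [← coeff_lagPoly_of_mem Φ p hk, h, coeff_lagPoly_of_mem]

theorem coeff_zero_one_sub_lagPoly (Φ : LagParams K) {w : O} (h0 : 0 ∉ K (w, w)) :
    (1 - lagPoly K Φ (w, w)).coeff 0 = 1 := by
  simp [coeff_lagPoly_of_notMem Φ (w, w) h0]

theorem one_sub_lagPoly_ne_zero (Φ : LagParams K) {w : O} (h0 : 0 ∉ K (w, w)) :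
    1 - lagPoly K Φ (w, w) ≠ 0 := by
  intro h
  simpa [h] using coeff_zero_one_sub_lagPoly Φ h0

theorem aeval_lagPoly (Φ : LagParams K) (p : O × O) (z : ℂ) :
    Polynomial.aeval z (lagPoly K Φ p) = ∑ k : {k // k ∈ K p}, (Φ p k : ℂ) * z ^ (k : ℕ) := by
  simp [lagPoly]

theorem continuous_aeval_lagPoly (p : O × O) :
    Continuous fun q : LagParams K × ℂ => Polynomial.aeval q.2 (lagPoly K q.1 p) := by
  simp only [aeval_lagPoly]
  fun_prop

/-- A nonzero coefficient at the largest self-lag makes the degree of the denominator maximal. -/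
theorem natDegree_one_sub_lagPoly_le (Φ Φ' : LagParams K) {w : O}
    (htop : ∀ h : (K (w, w)).Nonempty, Φ (w, w) ⟨(K (w, w)).max' h, Finset.max'_mem _ h⟩ ≠ 0)
    (h0 : 0 ∉ K (w, w)) :
    (1 - lagPoly K Φ' (w, w)).natDegree ≤ (1 - lagPoly K Φ (w, w)).natDegree := by
  rw [Polynomial.natDegree_le_iff_coeff_eq_zero]
  intro n hn
  have hn0 : n ≠ 0 := by omega
  have hnK : n ∉ K (w, w) := by
    intro hmem
    have hne : (K (w, w)).Nonempty := ⟨n, hmem⟩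
    have hmax := Finset.max'_mem _ hne
    have hle := Finset.le_max' _ n hmem
    have hm0 : (K (w, w)).max' hne ≠ 0 := fun h => h0 (h ▸ hmax)
    refine (hn.trans_le hle).not_ge (Polynomial.le_natDegree_of_ne_zero ?_)
    simpa [Polynomial.coeff_one, hm0, coeff_lagPoly_of_mem Φ (w, w) hmax] using htop hne
  simp [Polynomial.coeff_one, hn0, coeff_lagPoly_of_notMem Φ' (w, w) hnK]

end LagPoly

/-- A multiple of no larger degree and with the same constant coefficient `1` is equal. -/
theorem Polynomial.eq_of_dvd_of_natDegree_le_of_coeff_zero {f g : Polynomial ℝ} (hdvd : f ∣ g)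
    (hdeg : g.natDegree ≤ f.natDegree) (hf : f.coeff 0 = 1) (hg : g.coeff 0 = 1) : g = f := by
  obtain ⟨q, rfl⟩ := hdvd
  have hne : f * q ≠ 0 := fun h => by simp [h] at hg
  rw [Polynomial.natDegree_mul (left_ne_zero_of_mul hne) (right_ne_zero_of_mul hne)] at hdeg
  have hq := Polynomial.eq_C_of_natDegree_eq_zero (p := q) (by omega)
  rw [Polynomial.mul_coeff_zero, hf, one_mul] at hg
  rw [hq, hg, Polynomial.C_1, mul_one]

section Generic

variable {O : Type*} (K : O × O → Finset ℕ)

/-- The parameters for which numerator and denominator of the transfer function on the edge `p`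
have a common complex zero. -/
def commonZeroSet (p : O × O) : Set (LagParams K) :=
  {Φ | ∃ z : ℂ, Polynomial.aeval z (lagPoly K Φ p) = 0 ∧
    Polynomial.aeval z (1 - lagPoly K Φ (p.2, p.2)) = 0}

/-- The parameters for which the coefficient at the largest self-lag of `w` vanishes. -/
def topSelfLagZeroSet (w : O) : Set (LagParams K) :=
  {Φ | ∃ h : (K (w, w)).Nonempty, Φ (w, w) ⟨(K (w, w)).max' h, Finset.max'_mem _ h⟩ = 0}

variable {K}

/-- Off the two exceptional sets of an edge, its transfer function determines its parameters. -/
theorem eq_of_transferFn_eq (h0 : ∀ v : O, 0 ∉ K (v, v)) {Φ Φ' : LagParams K} {p : O × O}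
    (hcop : Φ ∉ commonZeroSet K p) (htop : Φ ∉ topSelfLagZeroSet K p.2)
    (h : transferFn K Φ' p.1 p.2 = transferFn K Φ p.1 p.2) :
    Φ' p = Φ p ∧ Φ' (p.2, p.2) = Φ (p.2, p.2) := by
  have hcop' : IsCoprime (1 - lagPoly K Φ (p.2, p.2)) (lagPoly K Φ p) := by
    rw [Polynomial.isCoprime_iff_aeval_ne_zero_of_isAlgClosed ℝ ℂ]
    intro z
    by_contra! hz
    exact hcop ⟨z, hz.2, hz.1⟩
  have hinj := IsFractionRing.injective (Polynomial ℝ) (RatFunc ℝ)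
  have hne := one_sub_lagPoly_ne_zero Φ (h0 p.2)
  have hne' := one_sub_lagPoly_ne_zero Φ' (h0 p.2)
  have hmul : lagPoly K Φ' p * (1 - lagPoly K Φ (p.2, p.2)) =
      lagPoly K Φ p * (1 - lagPoly K Φ' (p.2, p.2)) := by
    rw [transferFn, transferFn, div_eq_div_iff
      ((map_ne_zero_iff _ hinj).2 hne') ((map_ne_zero_iff _ hinj).2 hne),
      ← map_mul, ← map_mul] at h
    exact hinj h
  have hdvd : 1 - lagPoly K Φ (p.2, p.2) ∣ 1 - lagPoly K Φ' (p.2, p.2) :=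
    hcop'.dvd_of_dvd_mul_left (hmul ▸ dvd_mul_left _ _)
  have hden := Polynomial.eq_of_dvd_of_natDegree_le_of_coeff_zero hdvd
    (natDegree_one_sub_lagPoly_le Φ Φ' (fun hK hz => htop ⟨hK, hz⟩) (h0 p.2))
    (coeff_zero_one_sub_lagPoly Φ (h0 p.2)) (coeff_zero_one_sub_lagPoly Φ' (h0 p.2))
  rw [hden] at hmul
  exact ⟨eq_of_lagPoly_eq (mul_right_cancel₀ hne hmul), eq_of_lagPoly_eq (sub_right_injective hden)⟩

variable [Fintype O]

theorem measurableSet_commonZeroSet (p : O × O) : MeasurableSet (commonZeroSet K p) := by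
  have hclosed : IsClosed {q : LagParams K × ℂ | Polynomial.aeval q.2 (lagPoly K q.1 p) = 0 ∧
      Polynomial.aeval q.2 (1 - lagPoly K q.1 (p.2, p.2)) = 0} := by
    refine (isClosed_eq (continuous_aeval_lagPoly p) continuous_const).inter
      (isClosed_eq ?_ continuous_const)
    simp only [map_sub, map_one]
    exact continuous_const.sub (continuous_aeval_lagPoly _)
  have hsigma := (isSigmaCompact_univ.of_isClosed_subset hclosed
    (Set.subset_univ _)).image continuous_fst
  have himage : Prod.fst '' {q : LagParams K × ℂ | Polynomial.aeval q.2 (lagPoly K q.1 p) = 0 ∧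
      Polynomial.aeval q.2 (1 - lagPoly K q.1 (p.2, p.2)) = 0} = commonZeroSet K p := by
    ext Φ
    simp [commonZeroSet]
  rw [himage] at hsigma
  obtain ⟨S, hS, hU⟩ := hsigma
  rw [← hU]
  exact MeasurableSet.iUnion fun n => (hS n).measurableSet

theorem volume_commonZeroSet {p : O × O} (hp : p.1 ≠ p.2) (hK : (K p).Nonempty)
    (h0 : 0 ∉ K (p.2, p.2)) : volume (commonZeroSet K p) = 0 := by
  classical
  obtain ⟨k, hk⟩ := hK
  let e : LagParams K := Pi.single p (Pi.single ⟨k, hk⟩ 1)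
  refine measure_eq_zero_of_forall_line_null volume (measurableSet_commonZeroSet p) e fun Φ => Set.Finite.measure_zero ?_ _
  have hself : ∀ t : ℝ, lagPoly K (Φ + t • e) (p.2, p.2) =
      lagPoly K Φ (p.2, p.2) := by
    intro t
    have hne : (p.2, p.2) ≠ p := fun h => hp (congrArg Prod.fst h).symm
    simp [lagPoly, e, Pi.single_eq_of_ne hne]
  have hedge : ∀ (t : ℝ) (z : ℂ),
      Polynomial.aeval z (lagPoly K (Φ + t • e) p) =
        Polynomial.aeval z (lagPoly K Φ p) + t * z ^ k := by
    intro t z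
    simp [aeval_lagPoly, e, add_mul, Finset.sum_add_distrib, Pi.single_apply]
    rw [Finset.sum_eq_single ⟨k, hk⟩ (fun j _ hj => by simp [hj]) (by simp)]
    simp
  refine ((1 - lagPoly K Φ (p.2, p.2)).rootSet_finite ℂ |>.biUnion
    (t := fun z => {t : ℝ | Polynomial.aeval z (lagPoly K Φ p) + t * z ^ k = 0})
    fun z hz => Set.Subsingleton.finite ?_).subset ?_
  · have hz0 : z ≠ 0 := by
      rintro rfl
      have hroot := (Polynomial.mem_rootSet.1 hz).2
      rw [← Polynomial.coeff_zero_eq_aeval_zero', coeff_zero_one_sub_lagPoly Φ h0] at hroot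
      simp at hroot
    intro s hs t ht
    simp only [Set.mem_ofPred_eq] at hs ht
    have hst := mul_right_cancel₀ (pow_ne_zero k hz0) (add_left_cancel (hs.trans ht.symm))
    exact_mod_cast hst
  · rintro t ⟨z, hz, hz'⟩
    rw [hself] at hz'
    rw [hedge] at hz
    exact Set.mem_biUnion
      (Polynomial.mem_rootSet.2 ⟨one_sub_lagPoly_ne_zero Φ h0, hz'⟩) hz

theorem volume_topSelfLagZeroSet (w : O) : volume (topSelfLagZeroSet K w) = 0 := by
  classical
  by_cases hK : (K (w, w)).Nonempty
  · have hset : topSelfLagZeroSet K w =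
        {Φ | Φ (w, w) ⟨(K (w, w)).max' hK, Finset.max'_mem _ hK⟩ = 0} := by
      ext Φ
      simp [topSelfLagZeroSet, hK]
    rw [hset]
    refine measure_eq_zero_of_forall_line_null volume
      (isClosed_eq (by fun_prop) continuous_const).measurableSet
      (Pi.single (w, w) (Pi.single ⟨(K (w, w)).max' hK, Finset.max'_mem _ hK⟩ 1))
      fun Φ => Set.Subsingleton.measure_zero ?_ _
    intro s hs t ht
    simp only [Set.mem_ofPred_eq, Pi.add_apply, Pi.smul_apply, Pi.single_eq_same, smul_eq_mul,
      mul_one] at hs ht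
    linarith
  · simp [topSelfLagZeroSet, hK]

end Generic

/-- Generic injectivity of the parameterisation of the direct transfer function on the stable
region: outside a Lebesgue null set of stable `Φ`, the transfer functions determine every
coordinate of `Φ` that they involve; and if every vertex that has self-lags has an incoming
edge (so that all coordinates are involved), they determine `Φ`. -/
theorem transferFn_generically_injective {O : Type*} [Fintype O]
    (DO : Finset (O × O)) (hDO : ∀ p ∈ DO, p.1 ≠ p.2)
    (K : O × O → Finset ℕ)
    (hKedge : ∀ p ∈ DO, (K p).Nonempty)
    (hKself : ∀ v : O, 0 ∉ K (v, v))
    (hKother : ∀ p : O × O, p ∉ DO → p.1 ≠ p.2 → K p = ∅) :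
    volume {Φ : LagParams K | Φ ∈ stableRegion DO K ∧
        ∃ Φ' ∈ stableRegion DO K, ¬ SameEdgeParams DO K Φ Φ' ∧ SameTransfer DO K Φ Φ'} = 0 ∧
    ((∀ w : O, (K (w, w)).Nonempty → ∃ v : O, (v, w) ∈ DO) →
      volume {Φ : LagParams K | Φ ∈ stableRegion DO K ∧
        ∃ Φ' ∈ stableRegion DO K, Φ' ≠ Φ ∧ SameTransfer DO K Φ Φ'} = 0) := by
  have hnull : volume {Φ : LagParams K | Φ ∈ stableRegion DO K ∧
      ∃ Φ' ∈ stableRegion DO K, ¬ SameEdgeParams DO K Φ Φ' ∧ SameTransfer DO K Φ Φ'} = 0 := by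
    refine measure_mono_null (t := ⋃ p ∈ DO, commonZeroSet K p ∪ topSelfLagZeroSet K p.2) ?_ ?_
    · rintro Φ ⟨-, Φ', -, hne, hsame⟩
      by_contra hΦ
      simp only [Set.mem_iUnion, Set.mem_union, not_exists, not_or] at hΦ
      exact hne fun p hp => eq_of_transferFn_eq hKself (hΦ p hp).1 (hΦ p hp).2 (hsame p hp)
    · refine (measure_biUnion_null_iff DO.countable_toSet).2 fun p hp => measure_union_null ?_ ?_
      · exact volume_commonZeroSet (hDO p hp) (hKedge p hp) (hKself p.2)
      · exact volume_topSelfLagZeroSet p.2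
  refine ⟨hnull, fun hin => measure_mono_null ?_ hnull⟩
  rintro Φ ⟨hΦ, Φ', hΦ', hne, hsame⟩
  refine ⟨hΦ, Φ', hΦ', fun hedge => hne ?_, hsame⟩
  ext ⟨v, w⟩ k
  by_cases hp : (v, w) ∈ DO
  · rw [(hedge _ hp).1]
  · by_cases hvw : v = w
    · subst hvw
      obtain ⟨u, hu⟩ := hin v ⟨k, k.2⟩
      exact congrFun (hedge _ hu).2 k
    · have hk := k.2
      simp [hKother _ hp hvw] at hk
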